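/- Let F and G be non-constant meromorphic functions on ℂ and set H = (F''/F' − 2F'/(F−1)) − (G''/G' − 2G'/(G−1)). Suppose Ē_{m)}(1;F) = Ē_{m)}(1;G), F and G share ∞ IM, and H ≢ 0. Then N(r,∞;H) ≤ N̄(r,0;F|≥2) + N̄(r,0;G|≥2) + N̄_*(r,∞;F,G) + N̄_{F≥m+1}(r,1;F | G≠1) + N̄_{G≥m+1}(r,1;G | F≠1) + N̄_L(r,1;F) + N̄_L(r,1;G) + N̄_0(r,0;F') + N̄_0(r,0;G'). -/

import Mathlib

open MeasureTheory Filter Set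

noncomputable section

open Classical in

/-- The order of the (meromorphic-type) function `f` at the point `z₀`: the unique integer `n`
such that `f z = (z - z₀) ^ n * g z` near `z₀` with `g` analytic and nonvanishing at `z₀`
(junk value `0` if no such `n` exists). -/
def merOrd (f : ℂ → ℂ) (z₀ : ℂ) : ℤ :=
  if h : ∃ n : ℤ, ∃ g : ℂ → ℂ, AnalyticAt ℂ g z₀ ∧ g z₀ ≠ 0 ∧
      ∀ᶠ z in nhdsWithin z₀ {z₀}ᶜ, f z = (z - z₀) ^ n * g z
  then h.choose else 0

/-- The unintegrated counting function `n(t)` attached to an integer weight `w` on `ℂ`. -/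
def preCount (w : ℂ → ℤ) (t : ℝ) : ℝ := ∑ᶠ z ∈ {z : ℂ | ‖z‖ ≤ t}, ((w z : ℤ) : ℝ)

/-- The integrated Nevanlinna counting function
`N(r) = ∫₀^r (n(t) - n(0))/t dt + n(0) log r` attached to an integer weight `w`. -/
def intCount (w : ℂ → ℤ) (r : ℝ) : ℝ :=
  (∫ t in (0:ℝ)..r, (preCount w t - preCount w 0) / t) + preCount w 0 * Real.log r

/-- `N(r,∞;f)`: integrated counting function of the poles of `f`. -/
def Npoles (f : ℂ → ℂ) : ℝ → ℝ := intCount fun z => max (-(merOrd f z)) 0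

/-- `N̄(r,∞;f)`: reduced integrated counting function of the poles of `f`. -/
def NbarPoles (f : ℂ → ℂ) : ℝ → ℝ := intCount fun z => if merOrd f z < 0 then 1 else 0

/-- `N(r,0;f)`: integrated counting function of the zeros of `f`. -/
def Nzeros (f : ℂ → ℂ) : ℝ → ℝ := intCount fun z => max (merOrd f z) 0

/-- `N̄(r,0;f)`: reduced integrated counting function of the zeros of `f`. -/
def NbarZeros (f : ℂ → ℂ) : ℝ → ℝ := intCount fun z => if 0 < merOrd f z then 1 else 0

/-- `N(r,0;f∣≤p)`: counting function of the zeros of `f` of multiplicity at most `p`. -/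
def NzerosLe (p : ℤ) (f : ℂ → ℂ) : ℝ → ℝ :=
  intCount fun z => if 0 < merOrd f z ∧ merOrd f z ≤ p then merOrd f z else 0

/-- `N(r,0;f∣≥p)`: counting function of the zeros of `f` of multiplicity at least `p`. -/
def NzerosGe (p : ℤ) (f : ℂ → ℂ) : ℝ → ℝ :=
  intCount fun z => if 0 < merOrd f z ∧ p ≤ merOrd f z then merOrd f z else 0

/-- `N̄(r,0;f∣≥p)`: reduced counting function of the zeros of `f` of multiplicity at least `p`. -/
def NbarZerosGe (p : ℤ) (f : ℂ → ℂ) : ℝ → ℝ :=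
  intCount fun z => if 0 < merOrd f z ∧ p ≤ merOrd f z then 1 else 0

/-- `N_2(r,0;f) = N̄(r,0;f) + N̄(r,0;f∣≥2)`. -/
def N2zeros (f : ℂ → ℂ) (r : ℝ) : ℝ := NbarZeros f r + NbarZerosGe 2 f r

/-- The Nevanlinna proximity function `m(r,f)`. -/
def prox (f : ℂ → ℂ) (r : ℝ) : ℝ :=
  (2 * Real.pi)⁻¹ * ∫ θ in (0:ℝ)..(2 * Real.pi),
    max (Real.log ‖f ((r : ℂ) * Complex.exp ((θ : ℂ) * Complex.I))‖) 0

/-- The Nevanlinna characteristic function `T(r,f) = m(r,f) + N(r,∞;f)`. -/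
def nevT (f : ℂ → ℂ) (r : ℝ) : ℝ := prox f r + Npoles f r

/-- `S` is a quantity `S(r,f)`, i.e. `S(r) = o(T(r,f))` as `r → ∞` outside a possible
exceptional set `E` of finite linear measure. -/
def IsSmallWrt (S : ℝ → ℝ) (f : ℂ → ℂ) : Prop :=
  ∃ E : Set ℝ, volume E < ⊤ ∧
    Tendsto (fun r => S r / nevT f r) (atTop ⊓ 𝓟 Eᶜ) (nhds 0)

/-- `a` is a small function of `f`: `a` is meromorphic (`a ≢ ∞`) and `T(r,a) = S(r,f)`. -/
def SmallFn (a f : ℂ → ℂ) : Prop :=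
  MeromorphicOn a Set.univ ∧ IsSmallWrt (nevT a) f

/-- A meromorphic-type function is non-constant (it does not agree with a constant off a
countable set). -/
def NonConst (f : ℂ → ℂ) : Prop := ∀ c : ℂ, ¬ {z | f z ≠ c}.Countable

/-- `f ≢ 0` for a meromorphic-type function `f`. -/
def NotIdZero (f : ℂ → ℂ) : Prop := ¬ {z | f z ≠ 0}.Countable

/-- `Ē_{m)}(a;g)`: the set of distinct zeros of `g - a` of multiplicity at most `m`
(`m` a positive integer or `∞`). -/
def EbarSet (m : ℕ∞) (a g : ℂ → ℂ) : Set ℂ :=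
  {z | 0 < merOrd (fun w => g w - a w) z ∧
       ((merOrd (fun w => g w - a w) z).toNat : ℕ∞) ≤ m}

/-- A differential polynomial `P[f] = ∑_{j} b_j ∏_{i ≤ k} (f^{(i)})^{n_{ij}}` of order `k`
with `t` monomials: `coeff j = b_j` and `expo j i = n_{ij}`. -/
structure DiffPoly (k t : ℕ) where
  coeff : Fin t → ℂ → ℂ
  expo : Fin t → Fin (k + 1) → ℕ

namespace DiffPoly

variable {k t : ℕ}

/-- Evaluation `P[f]` of a differential polynomial on `f`. -/
def eval (P : DiffPoly k t) (f : ℂ → ℂ) : ℂ → ℂ := fun z =>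
  ∑ j, P.coeff j z * ∏ i, iteratedDeriv i.val f z ^ P.expo j i

/-- The degree `d(M_j)` of the `j`-th monomial. -/
def monDeg (P : DiffPoly k t) (j : Fin t) : ℕ := ∑ i, P.expo j i

/-- The weight `Γ_{M_j}` of the `j`-th monomial. -/
def monWt (P : DiffPoly k t) (j : Fin t) : ℕ := ∑ i, (i.val + 1) * P.expo j i

/-- The degree `d̄(P) = max_j d(M_j)`. -/
def degU (P : DiffPoly k t) : ℕ := Finset.univ.sup fun j => P.monDeg j

/-- The lower degree `d̲(P) = min_j d(M_j)`. -/
def degL (P : DiffPoly k t) : ℕ := sInf (Set.range fun j => P.monDeg j)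

/-- The weight `Γ_P = max_j Γ_{M_j}`. -/
def wt (P : DiffPoly k t) : ℕ := Finset.univ.sup fun j => P.monWt j

/-- `μ = max_j (Γ_{M_j} - d(M_j))`. -/
def mu (P : DiffPoly k t) : ℕ := Finset.univ.sup fun j => P.monWt j - P.monDeg j

/-- All coefficients of `P` are small functions of `f`. -/
def SmallCoeffs (P : DiffPoly k t) (f : ℂ → ℂ) : Prop := ∀ j, SmallFn (P.coeff j) f

/-- `P` contains at least one derivative of `f`. -/
def HasDerivTerm (P : DiffPoly k t) : Prop := ∃ j i, 1 ≤ i.val ∧ 0 < P.expo j i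

end DiffPoly

/-! ### Auxiliary lemmas -/

theorem merOrd_eq {f : ℂ → ℂ} {z : ℂ} (hf : MeromorphicAt f z) :
    merOrd f z = (meromorphicOrderAt f z).untop₀ := by
  unfold merOrd
  split_ifs with h
  · have h2 := (meromorphicOrderAt_eq_int_iff (n := h.choose) hf).2 (by
      simpa [smul_eq_mul] using h.choose_spec)
    rw [h2]; rfl
  · by_cases ht : meromorphicOrderAt f z = ⊤
    · simp [ht]
    · exfalso
      apply h
      lift meromorphicOrderAt f z to ℤ using ht with n hn
      obtain ⟨g, h1, h2, h3⟩ := (meromorphicOrderAt_eq_int_iff hf).1 hn.symm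
      exact ⟨n, g, h1, h2, by simpa [smul_eq_mul] using h3⟩

theorem order_of_merOrd_ne {f : ℂ → ℂ} {z : ℂ} (hf : MeromorphicAt f z) (h : merOrd f z ≠ 0) :
    meromorphicOrderAt f z = (merOrd f z : ℤ) := by
  rw [merOrd_eq hf] at h ⊢
  by_cases ht : meromorphicOrderAt f z = ⊤
  · simp [ht] at h
  · exact (WithTop.coe_untop₀_of_ne_top ht).symm

theorem merOrd_nonneg_iff {f : ℂ → ℂ} {z : ℂ} (hf : MeromorphicAt f z) :
    0 ≤ merOrd f z ↔ 0 ≤ meromorphicOrderAt f z := by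
  rw [merOrd_eq hf]
  cases h : meromorphicOrderAt f z with
  | top => simp
  | coe n => simp

theorem merOrd_of_eq {f : ℂ → ℂ} {z : ℂ} {n : ℤ} (hf : MeromorphicAt f z)
    (h : meromorphicOrderAt f z = n) : merOrd f z = n := by
  rw [merOrd_eq hf, h]; rfl

/-- Logarithmic derivative has a simple pole with residue the order. -/
theorem logDeriv_local {f : ℂ → ℂ} {z : ℂ} (hf : MeromorphicAt f z) :
    ∃ h : ℂ → ℂ, AnalyticAt ℂ h z ∧
      ∀ᶠ w in nhdsWithin z {z}ᶜ, deriv f w / f w = (merOrd f z : ℂ) / (w - z) + h w := by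
  by_cases ht : meromorphicOrderAt f z = ⊤
  · refine ⟨fun _ => 0, analyticAt_const, ?_⟩
    rw [merOrd_eq hf, ht]
    filter_upwards [meromorphicOrderAt_eq_top_iff.1 ht] with w hw
    simp [hw]
  · have hn : meromorphicOrderAt f z = (merOrd f z : ℤ) := by
      rw [merOrd_eq hf]; exact (WithTop.coe_untop₀_of_ne_top ht).symm
    obtain ⟨g, h1, h2, h3⟩ := (meromorphicOrderAt_eq_int_iff hf).1 hn
    refine ⟨fun w => deriv g w / g w, h1.deriv.div h1 h2, ?_⟩
    have h3' : f =ᶠ[nhdsWithin z {z}ᶜ] fun w => (w - z) ^ (merOrd f z) * g w := by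
      filter_upwards [h3] with w hw
      simpa using hw
    filter_upwards [h3', h3'.nhdsNE_deriv,
      h1.eventually_analyticAt.filter_mono nhdsWithin_le_nhds,
      (h1.continuousAt.eventually_ne h2).filter_mono nhdsWithin_le_nhds,
      eventually_mem_nhdsWithin] with w e1 e2 e3 e4 e5
    have hw : w - z ≠ 0 := sub_ne_zero.2 e5
    have hd : HasDerivAt (fun w => (w - z) ^ (merOrd f z) * g w)
        ((merOrd f z : ℂ) * (w - z) ^ (merOrd f z - 1) * 1 * g w
          + (w - z) ^ (merOrd f z) * deriv g w) w := by
      refine HasDerivAt.mul ?_ e3.differentiableAt.hasDerivAt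
      exact (hasDerivAt_zpow (merOrd f z) (w - z) (Or.inl hw)).comp w
        ((hasDerivAt_id w).sub_const z)
    rw [e2, hd.deriv, e1, zpow_sub_one₀ hw]
    have := zpow_ne_zero (merOrd f z) hw
    field_simp

theorem merOrd_deriv {f : ℂ → ℂ} {z : ℂ} (hf : MeromorphicAt f z) (h : merOrd f z ≠ 0) :
    merOrd (deriv f) z = merOrd f z - 1 := by
  apply merOrd_of_eq hf.deriv
  exact_mod_cast meromorphicOrderAt_deriv_eq_sub_one (n := merOrd f z) (by exact_mod_cast h)
    (order_of_merOrd_ne hf h)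

theorem merOrd_deriv_nonneg {f : ℂ → ℂ} {z : ℂ} (hf : MeromorphicAt f z) (h : merOrd f z = 0) :
    0 ≤ merOrd (deriv f) z := by
  rw [merOrd_nonneg_iff hf.deriv]
  have h0 := (merOrd_nonneg_iff hf).1 h.ge
  obtain ⟨g, hg, hfg⟩ := (MeromorphicAt.meromorphicOrderAt_nonneg_iff hf).1 h0
  rw [meromorphicOrderAt_congr (Filter.EventuallyEq.nhdsNE_deriv hfg)]
  exact hg.deriv.meromorphicOrderAt_nonneg

theorem merOrd_sub_one {f : ℂ → ℂ} {z : ℂ} (hf : MeromorphicAt f z) (c : ℂ)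
    (h : merOrd f z < 0) : merOrd (fun w => f w - c) z = merOrd f z := by
  have hc : MeromorphicAt (fun _ : ℂ => -c) z := MeromorphicAt.const _ _
  have e : (fun w => f w - c) = f + fun _ => -c := by
    funext w; simp [sub_eq_add_neg]
  have ho := order_of_merOrd_ne hf h.ne
  rw [e]
  apply merOrd_of_eq (hf.add hc)
  rw [meromorphicOrderAt_add_eq_left_of_lt hc, ho]
  have : (0 : WithTop ℤ) ≤ meromorphicOrderAt (fun _ : ℂ => -c) z :=
    analyticAt_const.meromorphicOrderAt_nonneg
  rw [ho]
  exact lt_of_lt_of_le (by exact_mod_cast h) this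

/-- `H`-type function: simple pole bound. -/
theorem merOrd_simple {f h : ℂ → ℂ} {z : ℂ} (hf : MeromorphicAt f z) (c : ℤ)
    (hh : AnalyticAt ℂ h z)
    (he : ∀ᶠ w in nhdsWithin z {z}ᶜ, f w = (c : ℂ) / (w - z) + h w) :
    -1 ≤ merOrd f z ∧ (c = 0 → 0 ≤ merOrd f z) := by
  constructor
  · have ha : AnalyticAt ℂ (fun w => (c : ℂ) + (w - z) * h w) z := by fun_prop
    have hlin : meromorphicOrderAt (fun w : ℂ => (w - z)) z = (1 : ℤ) := by
      have hm : MeromorphicAt (fun w : ℂ => w - z) z := by fun_prop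
      rw [meromorphicOrderAt_eq_int_iff hm]
      exact ⟨fun _ => 1, analyticAt_const, one_ne_zero, by simp⟩
    have hm : MeromorphicAt (fun w : ℂ => w - z) z := by fun_prop
    have key : meromorphicOrderAt ((fun w : ℂ => w - z) * f) z
        = meromorphicOrderAt (fun w => (c : ℂ) + (w - z) * h w) z := by
      apply meromorphicOrderAt_congr
      filter_upwards [he, eventually_mem_nhdsWithin] with w hw hne
      have : w - z ≠ 0 := sub_ne_zero.2 hne
      simp only [Pi.mul_apply, hw]
      field_simp
    rw [meromorphicOrderAt_mul hm hf, hlin] at key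
    have h0 := ha.meromorphicOrderAt_nonneg
    rw [← key] at h0
    rw [merOrd_eq hf]
    cases ho : meromorphicOrderAt f z with
    | top => simp
    | coe n =>
      rw [ho] at h0
      have : (0 : ℤ) ≤ 1 + n := by exact_mod_cast h0
      simp only [WithTop.untop₀_coe]
      omega
  · intro hc
    rw [merOrd_nonneg_iff hf, meromorphicOrderAt_congr (f₂ := h)]
    · exact hh.meromorphicOrderAt_nonneg
    · filter_upwards [he] with w hw
      simpa [hc] using hw

/-- All the local order relations for a single function. -/
theorem local_orders {f : ℂ → ℂ} {z : ℂ} (hf : MeromorphicAt f z) :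
    (merOrd (fun w => f w - 1) z ≠ 0 → merOrd (deriv f) z = merOrd (fun w => f w - 1) z - 1) ∧
    (merOrd (fun w => f w - 1) z = 0 → 0 ≤ merOrd (deriv f) z) ∧
    (merOrd f z ≠ 0 → merOrd (deriv f) z = merOrd f z - 1) ∧
    (merOrd f z < 0 → merOrd (fun w => f w - 1) z = merOrd f z) ∧
    (merOrd (fun w => f w - 1) z < 0 → merOrd f z = merOrd (fun w => f w - 1) z) := by
  have hf1 : MeromorphicAt (fun w => f w - 1) z := hf.sub (MeromorphicAt.const 1 z)
  have hd : deriv (fun w => f w - 1) = deriv f := by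
    funext w; exact deriv_sub_const (f := f) 1
  refine ⟨fun h => ?_, fun h => ?_, merOrd_deriv hf, merOrd_sub_one hf 1, fun h => ?_⟩
  · rw [← merOrd_deriv hf1 h, hd]
  · rw [← hd]; exact merOrd_deriv_nonneg hf1 h
  · rw [← merOrd_sub_one hf1 (-1) h]; simp

theorem local_expansion {f : ℂ → ℂ} {z : ℂ} (hf : MeromorphicAt f z) :
    ∃ h : ℂ → ℂ, AnalyticAt ℂ h z ∧
      ∀ᶠ w in nhdsWithin z {z}ᶜ,
        deriv (deriv f) w / deriv f w - 2 * deriv f w / (f w - 1) =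
          ((merOrd (deriv f) z - 2 * merOrd (fun w => f w - 1) z : ℤ) : ℂ) / (w - z) + h w := by
  have hf1 : MeromorphicAt (fun w => f w - 1) z := hf.sub (MeromorphicAt.const 1 z)
  have hd : deriv (fun w => f w - 1) = deriv f := by
    funext w; exact deriv_sub_const (f := f) 1
  obtain ⟨h1, a1, e1⟩ := logDeriv_local hf.deriv
  obtain ⟨h2, a2, e2⟩ := logDeriv_local hf1
  refine ⟨fun w => h1 w - 2 * h2 w, a1.sub (analyticAt_const.mul a2), ?_⟩
  filter_upwards [e1, e2] with w e1 e2
  rw [hd] at e2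
  rw [mul_div_assoc, e1, e2]
  push_cast
  ring

theorem merOrd_finite {f : ℂ → ℂ} (hf : MeromorphicOn f Set.univ) (r : ℝ) :
    {z : ℂ | ‖z‖ ≤ r ∧ merOrd f z ≠ 0}.Finite := by
  have hr : MeromorphicOn f (Metric.closedBall (0 : ℂ) r) := fun z _ => hf z (Set.mem_univ z)
  refine ((MeromorphicOn.divisor f (Metric.closedBall (0 : ℂ) r)).finiteSupport
    (isCompact_closedBall 0 r)).subset ?_
  rintro z ⟨h1, h2⟩
  have hz : z ∈ Metric.closedBall (0 : ℂ) r := by simpa using h1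
  rw [Function.mem_support, MeromorphicOn.divisor_apply hr hz, ← merOrd_eq (hf z (Set.mem_univ z))]
  exact h2

/-- The kernel by which a point contributes to the integrated counting function. -/
def cKer (r : ℝ) (z : ℂ) : ℝ :=
  (∫ t in (0:ℝ)..r, (if ‖z‖ ≤ t ∧ z ≠ 0 then 1 / t else 0)) + (if z = 0 then Real.log r else 0)

theorem cKer_nonneg {r : ℝ} (hr : 1 ≤ r) (z : ℂ) : 0 ≤ cKer r z := by
  unfold cKer
  apply add_nonneg
  · apply intervalIntegral.integral_nonneg (by linarith)
    intro t ht
    split_ifs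
    · exact one_div_nonneg.2 ht.1
    · exact le_rfl
  · split_ifs
    · exact Real.log_nonneg hr
    · exact le_rfl

theorem cKer_integrable (r : ℝ) (z : ℂ) :
    IntervalIntegrable (fun t : ℝ => if ‖z‖ ≤ t ∧ z ≠ 0 then 1 / t else 0) volume 0 r := by
  by_cases hz : z = 0
  · simp [hz]
  · have hz' : 0 < ‖z‖ := norm_pos_iff.2 hz
    have hmeas : Measurable (fun t : ℝ => if ‖z‖ ≤ t ∧ z ≠ 0 then 1 / t else 0) := by
      apply Measurable.ite
      · simp only [hz, ne_eq, not_false_eq_true, and_true]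
        exact measurableSet_Ici
      · fun_prop
      · fun_prop
    refine (intervalIntegrable_const (c := 1 / ‖z‖)).mono_fun hmeas.aestronglyMeasurable ?_
    refine Filter.Eventually.of_forall fun t => ?_
    beta_reduce
    split_ifs with h
    · have ht : 0 < t := lt_of_lt_of_le hz' h.1
      rw [Real.norm_of_nonneg (by positivity), Real.norm_of_nonneg (by positivity)]
      exact one_div_le_one_div_of_le hz' h.1
    · simp

theorem intCount_eq {w : ℂ → ℤ} {r : ℝ} (hr : 1 ≤ r) (S : Finset ℂ)
    (hS : ∀ z, ‖z‖ ≤ r → w z ≠ 0 → z ∈ S) :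
    intCount w r = ∑ z ∈ S, (w z : ℝ) * cKer r z := by
  have hpre : ∀ t ≤ r, preCount w t = ∑ z ∈ S, if ‖z‖ ≤ t then (w z : ℝ) else 0 := by
    intro t ht
    unfold preCount
    rw [← Finset.sum_filter]
    apply finsum_mem_eq_sum_of_inter_support_eq
    ext z
    simp only [Set.mem_inter_iff, Set.mem_ofPred_eq, Function.mem_support, Finset.coe_filter]
    constructor
    · rintro ⟨h1, h2⟩
      exact ⟨⟨hS z (h1.trans ht) (by exact_mod_cast h2), h1⟩, h2⟩
    · rintro ⟨⟨_, h1⟩, h2⟩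
      exact ⟨h1, h2⟩
  have hint : (∫ t in (0:ℝ)..r, (preCount w t - preCount w 0) / t)
      = ∫ t in (0:ℝ)..r, ∑ z ∈ S, (w z : ℝ) * (if ‖z‖ ≤ t ∧ z ≠ 0 then 1 / t else 0) := by
    apply intervalIntegral.integral_congr
    intro t ht
    rw [Set.uIcc_of_le (by linarith)] at ht
    simp only
    rw [hpre t ht.2, hpre 0 (by linarith), ← Finset.sum_sub_distrib, Finset.sum_div]
    refine Finset.sum_congr rfl fun z _ => ?_
    by_cases hz : z = 0
    · simp [hz, ht.1]
    · have : ¬ ‖z‖ ≤ 0 := by simpa using hz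
      by_cases h2 : ‖z‖ ≤ t
      · simp [hz, h2, div_eq_mul_inv]
      · simp [hz, h2]
  unfold intCount
  rw [hint, intervalIntegral.integral_finsetSum
    (fun z _ => (cKer_integrable r z).const_mul _), hpre 0 (by linarith), Finset.sum_mul,
    ← Finset.sum_add_distrib]
  refine Finset.sum_congr rfl fun z _ => ?_
  rw [intervalIntegral.integral_const_mul]
  unfold cKer
  by_cases hz : z = 0
  · simp [hz]
  · have : ¬ ‖z‖ ≤ 0 := by simpa using hz
    simp [hz]

/-- **Lemma 2.1**: if `Ē_{m)}(1;F) = Ē_{m)}(1;G)`, `F` and `G` share `∞` IM and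
`H = (F''/F' - 2F'/(F-1)) - (G''/G' - 2G'/(G-1)) ≢ 0`, then
`N(r,∞;H) ≤ N̄(r,0;F∣≥2) + N̄(r,0;G∣≥2) + N̄_*(r,∞;F,G) + N̄_{F≥m+1}(r,1;F ∣ G≠1)
+ N̄_{G≥m+1}(r,1;G ∣ F≠1) + N̄_L(r,1;F) + N̄_L(r,1;G) + N̄₀(r,0;F') + N̄₀(r,0;G')`. -/
theorem counting_bound_for_H
    (F G : ℂ → ℂ) (hF : MeromorphicOn F Set.univ) (hG : MeromorphicOn G Set.univ)
    (hFnc : NonConst F) (hGnc : NonConst G)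
    (m : ℕ∞) (hm : 1 ≤ m)
    (hshare1 : EbarSet m (fun _ => 1) F = EbarSet m (fun _ => 1) G)
    (hshareInf : {z | merOrd F z < 0} = {z | merOrd G z < 0})
    (H : ℂ → ℂ)
    (hH : H = fun z =>
      (deriv (deriv F) z / deriv F z - 2 * deriv F z / (F z - 1)) -
      (deriv (deriv G) z / deriv G z - 2 * deriv G z / (G z - 1)))
    (hH0 : NotIdZero H) :
    ∀ r : ℝ, 1 ≤ r →
      Npoles H r ≤
        -- N̄(r,0;F∣≥2) + N̄(r,0;G∣≥2)
        NbarZerosGe 2 F r + NbarZerosGe 2 G r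
        -- N̄_*(r,∞;F,G)
        + intCount (fun z => if merOrd F z < 0 ∧ merOrd F z ≠ merOrd G z then 1 else 0) r
        -- N̄_{F≥m+1}(r,1;F ∣ G≠1)
        + intCount (fun z =>
            if (0 < merOrd (fun w => F w - 1) z ∧
                  m + 1 ≤ ((merOrd (fun w => F w - 1) z).toNat : ℕ∞)) ∧
               merOrd (fun w => G w - 1) z ≤ 0 then 1 else 0) r
        -- N̄_{G≥m+1}(r,1;G ∣ F≠1)
        + intCount (fun z =>
            if (0 < merOrd (fun w => G w - 1) z ∧
                  m + 1 ≤ ((merOrd (fun w => G w - 1) z).toNat : ℕ∞)) ∧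
               merOrd (fun w => F w - 1) z ≤ 0 then 1 else 0) r
        -- N̄_L(r,1;F)
        + intCount (fun z =>
            if 0 < merOrd (fun w => G w - 1) z ∧
               merOrd (fun w => G w - 1) z < merOrd (fun w => F w - 1) z then 1 else 0) r
        -- N̄_L(r,1;G)
        + intCount (fun z =>
            if 0 < merOrd (fun w => F w - 1) z ∧
               merOrd (fun w => F w - 1) z < merOrd (fun w => G w - 1) z then 1 else 0) r
        -- N̄₀(r,0;F')
        + intCount (fun z =>
            if 0 < merOrd (deriv F) z ∧ ¬ 0 < merOrd F z ∧
               ¬ 0 < merOrd (fun w => F w - 1) z then 1 else 0) r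
        -- N̄₀(r,0;G')
        + intCount (fun z =>
            if 0 < merOrd (deriv G) z ∧ ¬ 0 < merOrd G z ∧
               ¬ 0 < merOrd (fun w => G w - 1) z then 1 else 0) r := by
  intro r hr
  have fF : ∀ z, MeromorphicAt F z := fun z => hF z (Set.mem_univ z)
  have fG : ∀ z, MeromorphicAt G z := fun z => hG z (Set.mem_univ z)
  have hF1 : MeromorphicOn (fun w => F w - 1) Set.univ :=
    fun z _ => (fF z).sub (MeromorphicAt.const 1 z)
  have hG1 : MeromorphicOn (fun w => G w - 1) Set.univ :=
    fun z _ => (fG z).sub (MeromorphicAt.const 1 z)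
  have hHm : ∀ z, MeromorphicAt H z := by
    intro z
    rw [hH]
    have a := fF z
    have b := fG z
    have a1 := hF1 z (Set.mem_univ z)
    have b1 := hG1 z (Set.mem_univ z)
    have c2 : MeromorphicAt (fun _ : ℂ => (2 : ℂ)) z := MeromorphicAt.const 2 z
    exact ((a.deriv.deriv.div a.deriv).sub ((c2.mul a.deriv).div a1)).sub
      ((b.deriv.deriv.div b.deriv).sub ((c2.mul b.deriv).div b1))
  -- the local bound on the order of `H`
  have hHo : ∀ z, -1 ≤ merOrd H z ∧
      ((merOrd (deriv F) z - 2 * merOrd (fun w => F w - 1) z) -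
        (merOrd (deriv G) z - 2 * merOrd (fun w => G w - 1) z) = 0 → 0 ≤ merOrd H z) := by
    intro z
    obtain ⟨h1, a1, e1⟩ := local_expansion (fF z)
    obtain ⟨h2, a2, e2⟩ := local_expansion (fG z)
    refine merOrd_simple (hHm z) _ (a1.sub a2) ?_
    filter_upwards [e1, e2] with w e1 e2
    rw [hH]
    simp only [Pi.sub_apply]
    rw [e1, e2]
    push_cast
    ring
  have hfin : ({z : ℂ | ‖z‖ ≤ r ∧ merOrd F z ≠ 0} ∪ {z : ℂ | ‖z‖ ≤ r ∧ merOrd G z ≠ 0}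
      ∪ {z : ℂ | ‖z‖ ≤ r ∧ merOrd (fun w => F w - 1) z ≠ 0}
      ∪ {z : ℂ | ‖z‖ ≤ r ∧ merOrd (fun w => G w - 1) z ≠ 0}
      ∪ {z : ℂ | ‖z‖ ≤ r ∧ merOrd (deriv F) z ≠ 0}
      ∪ {z : ℂ | ‖z‖ ≤ r ∧ merOrd (deriv G) z ≠ 0}).Finite :=
    (((((merOrd_finite hF r).union (merOrd_finite hG r)).union (merOrd_finite hF1 r)).union
      (merOrd_finite hG1 r)).union (merOrd_finite hF.deriv r)).union (merOrd_finite hG.deriv r)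
  have hS : ∀ z, ‖z‖ ≤ r → ¬ (merOrd F z = 0 ∧ merOrd G z = 0 ∧
      merOrd (fun w => F w - 1) z = 0 ∧ merOrd (fun w => G w - 1) z = 0 ∧
      merOrd (deriv F) z = 0 ∧ merOrd (deriv G) z = 0) → z ∈ hfin.toFinset := by
    intro z hz h
    simp only [Set.Finite.mem_toFinset, Set.mem_union, Set.mem_ofPred_eq]
    tauto
  unfold Npoles NbarZerosGe
  rw [intCount_eq hr hfin.toFinset, intCount_eq hr hfin.toFinset, intCount_eq hr hfin.toFinset,
    intCount_eq hr hfin.toFinset, intCount_eq hr hfin.toFinset, intCount_eq hr hfin.toFinset,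
    intCount_eq hr hfin.toFinset, intCount_eq hr hfin.toFinset, intCount_eq hr hfin.toFinset,
    intCount_eq hr hfin.toFinset]
  rotate_left
  iterate 10
    · intro z hz h
      refine hS z hz ?_
      rintro ⟨h1, h2, h3, h4, h5, h6⟩
      have := (hHo z).2 (by rw [h3, h4, h5, h6]; rfl)
      apply h
      simp [h1, h2, h3, h4, h5, h6, this]
  simp only [← Finset.sum_add_distrib, ← add_mul]
  refine Finset.sum_le_sum fun z _ => mul_le_mul_of_nonneg_right ?_ (cKer_nonneg hr z)
  simp only [← Int.cast_add, Int.cast_le]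
  obtain ⟨oH1, oH2⟩ := hHo z
  obtain ⟨f1, f2, f3, f4, f5⟩ := local_orders (fF z)
  obtain ⟨g1, g2, g3, g4, g5⟩ := local_orders (fG z)
  have s1 : (0 < merOrd (fun w => F w - 1) z ∧
      ((merOrd (fun w => F w - 1) z).toNat : ℕ∞) ≤ m) ↔ (0 < merOrd (fun w => G w - 1) z ∧
      ((merOrd (fun w => G w - 1) z).toNat : ℕ∞) ≤ m) := Set.ext_iff.1 hshare1 z
  have s2 : merOrd F z < 0 ↔ merOrd G z < 0 := Set.ext_iff.1 hshareInf z
  have hlt : ∀ n : ℕ, ¬ ((n : ℕ∞) ≤ m) → m + 1 ≤ (n : ℕ∞) := fun n hn =>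
    Order.add_one_le_of_lt (not_le.1 hn)
  have u1 := hlt (merOrd (fun w => F w - 1) z).toNat
  have u2 := hlt (merOrd (fun w => G w - 1) z).toNat
  generalize merOrd (fun w => F w - 1) z = a1 at *
  generalize merOrd (fun w => G w - 1) z = b1 at *
  generalize merOrd F z = a at *
  generalize merOrd G z = b at *
  generalize merOrd (deriv F) z = a' at *
  generalize merOrd (deriv G) z = b' at *
  generalize merOrd H z = n at *
  clear hlt hS hHo hshare1 hshareInf
  have key : max (-n) 0 ≤ 1 := by omega
  have one : ∀ (p : Prop) [Decidable p], 0 ≤ (if p then (1 : ℤ) else 0) := by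
    intro p _; split_ifs <;> simp
  by_cases hc : a' - 2 * a1 - (b' - 2 * b1) = 0
  · have : max (-n) 0 = 0 := by have := oH2 hc; omega
    rw [this]
    positivity
  · refine key.trans ?_
    by_contra hcon
    rcases lt_trichotomy a1 0 with ha | ha | ha <;> rcases lt_trichotomy b1 0 with hb | hb | hb <;>
      first
        | grind
        | (have fa := f1 (by omega)
           have ga := g1 (by omega)
           clear f1 f2 g1 g2 s1 u1 u2 oH2
           have hne : a1 ≠ b1 := by omega
           grind)
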